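/- arXiv:cs/0506102 — 2 statements merged into one kernel-verified Lean document; each statement's English description precedes it below -/
import Mathlib

section
/- Let F_q be a finite field, m ≥ 1, and k_1, ..., k_m nonnegative integers with each k_i < q-1. The m-dimensional toric code obtained by evaluating the span of the monomials x_1^{e_1}···x_m^{e_m} with 0 ≤ e_i ≤ k_i for all i, at all points of (F_q^*)^m, has minimum distance exactly ∏_{i=1}^m ((q-1) − k_i). -/
open Polynomial in
/-- A nonzero polynomial of degree at most `k` is nonzero at at least `|Fˣ| - k` units. -/
theorem card_units_sub_le_card_eval_ne_zero {F : Type*} [Field F] [Fintype F] [DecidableEq F]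
    {P : F[X]} {k : ℕ} (hP : P ≠ 0) (hdeg : P.natDegree ≤ k) :
    Fintype.card Fˣ - k ≤ (Finset.univ.filter fun a : Fˣ => P.eval (a : F) ≠ 0).card := by
  have hroots : (Finset.univ.filter fun a : Fˣ => P.eval (a : F) = 0).card ≤ k := by
    refine le_trans ?_ ((P.roots.toFinset_card_le.trans P.card_roots').trans hdeg)
    refine Finset.card_le_card_of_injOn (fun a => (a : F)) ?_ Units.val_injective.injOn
    intro a ha
    simpa [hP] using ha
  have := Finset.card_filter_add_card_filter_not (s := (Finset.univ : Finset Fˣ))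
    (fun a : Fˣ => P.eval (a : F) = 0)
  rw [Finset.card_univ] at this
  simp only [ne_eq]
  omega

/-- If every axis-parallel line in direction `i` through a point of `S` meets `S` in at least
`d i` points, then a nonempty `S` has at least `∏ i, d i` points. -/
theorem prod_le_card_of_forall_line {α : Type*} [Fintype α] [DecidableEq α] :
    ∀ {m : ℕ} (d : Fin m → ℕ) (S : Finset (Fin m → α)), S.Nonempty →
      (∀ i, ∀ p ∈ S, d i ≤ (Finset.univ.filter fun a => Function.update p i a ∈ S).card) →
      ∏ i, d i ≤ S.card
  | 0, d, S, hS, _ => by simpa using hS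
  | m + 1, d, S, ⟨p, hp⟩, h => by
    let T : Finset α := Finset.univ.filter fun a => Function.update p 0 a ∈ S
    let fiber (a : α) : Finset (Fin m → α) := Finset.univ.filter fun x => Fin.cons a x ∈ S
    have hfiber : ∀ a ∈ T, ∏ i : Fin m, d i.succ ≤ (fiber a).card := by
      intro a ha
      refine prod_le_card_of_forall_line _ _ ⟨Fin.tail p, ?_⟩ fun i x hx => ?_
      · have ha' : Function.update p 0 a ∈ S := by simpa [T] using ha
        rw [← Fin.cons_self_tail p, Fin.update_cons_zero] at ha'
        simpa [fiber] using ha'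
      · have hx' : Fin.cons a x ∈ S := by simpa [fiber] using hx
        simpa [fiber, Fin.cons_update] using h i.succ _ hx'
    calc ∏ i, d i = d 0 * ∏ i : Fin m, d i.succ := Fin.prod_univ_succ d
      _ ≤ T.card * ∏ i : Fin m, d i.succ := Nat.mul_le_mul_right _ (h 0 p hp)
      _ ≤ ∑ a ∈ T, (fiber a).card := by
        simpa using Finset.card_nsmul_le_sum T _ _ hfiber
      _ = (T.sigma fiber).card := (Finset.card_sigma _ _).symm
      _ ≤ S.card := by
        refine Finset.card_le_card_of_injOn (fun z => Fin.cons z.1 z.2) ?_ ?_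
        · rintro ⟨a, x⟩ hz
          simpa [fiber] using (Finset.mem_sigma.1 hz).2
        · rintro ⟨a, x⟩ - ⟨b, y⟩ - hxy
          obtain ⟨rfl, rfl⟩ := Fin.cons_inj.1 hxy
          rfl

open Polynomial in
/-- The restriction of a box polynomial to an axis-parallel line in direction `i` is a univariate
polynomial of degree at most `k i`. -/
theorem exists_polynomial_eval_update {F : Type*} [Field F] {m : ℕ} (k : Fin m → ℕ)
    (c : (∀ i, Fin (k i + 1)) → F) (i : Fin m) (p : Fin m → Fˣ) :
    ∃ P : F[X], P.natDegree ≤ k i ∧ ∀ a : Fˣ, P.eval (a : F) =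
      ∑ e, c e * ∏ j, (Function.update p i a j : F) ^ ((e j : ℕ)) := by
  refine ⟨∑ e : ∀ i, Fin (k i + 1),
    C (c e * ∏ j ∈ Finset.univ.erase i, (p j : F) ^ ((e j : ℕ))) * X ^ ((e i : ℕ)), ?_, fun a => ?_⟩
  · exact natDegree_sum_le_of_forall_le _ _ fun e _ =>
      (natDegree_C_mul_X_pow_le _ _).trans (Nat.le_of_lt_succ (e i).isLt)
  · rw [eval_finsetSum]
    refine Finset.sum_congr rfl fun e _ => ?_
    have hline : ∏ j ∈ Finset.univ.erase i, (Function.update p i a j : F) ^ ((e j : ℕ)) =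
        ∏ j ∈ Finset.univ.erase i, (p j : F) ^ ((e j : ℕ)) :=
      Finset.prod_congr rfl fun j hj => by
        rw [Function.update_of_ne (Finset.ne_of_mem_erase hj)]
    rw [← Finset.mul_prod_erase _ _ (Finset.mem_univ i), Function.update_self, hline]
    simp only [eval_mul, eval_C, eval_pow, eval_X]
    ring

open Polynomial in
/-- A product of univariate polynomials of degrees at most `k i` is a box polynomial. -/
theorem prod_eval_eq_sum_box {F : Type*} [Field F] {m : ℕ} (k : Fin m → ℕ) (P : Fin m → F[X])
    (hP : ∀ i, (P i).natDegree ≤ k i) (x : Fin m → F) :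
    ∏ i, (P i).eval (x i) =
      ∑ e : ∀ i, Fin (k i + 1), (∏ i, (P i).coeff (e i)) * ∏ i, x i ^ ((e i : ℕ)) := by
  simp_rw [fun i => eval_eq_sum_range' (Nat.lt_succ_of_le (hP i)) (x i), Finset.sum_range,
    ← Finset.prod_mul_distrib]
  rw [Finset.prod_univ_sum, Fintype.piFinset_univ]

/-- The toric code of the box `[0,k₁] × ⋯ × [0,k_m]` over `F_q` has minimum distance
exactly `∏ i, ((q-1) - k i)`. -/
theorem box_toric_code_min_dist {F : Type*} [Field F] [Fintype F]
    (q m : ℕ) (hm : 1 ≤ m) (k : Fin m → ℕ)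
    (hq : Fintype.card F = q) (hk : ∀ i, k i < q - 1)
    (C : Set ((Fin m → Fˣ) → F))
    (hC : C = {w | ∃ c : (∀ i, Fin (k i + 1)) → F,
      w = fun p => ∑ e : ∀ i, Fin (k i + 1), c e * ∏ i, (p i : F) ^ ((e i : ℕ))}) :
    (∀ w ∈ C, w ≠ 0 → ∏ i, (q - 1 - k i) ≤ {p | w p ≠ 0}.ncard) ∧
    (∃ w ∈ C, w ≠ 0 ∧ {p | w p ≠ 0}.ncard = ∏ i, (q - 1 - k i)) := by
  classical
  have hcard : Fintype.card Fˣ = q - 1 := by rw [Fintype.card_units, hq]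
  subst hC
  constructor
  · rintro w ⟨c, rfl⟩ hw
    obtain ⟨p₀, hp₀⟩ := Function.ne_iff.1 hw
    rw [Set.ncard_eq_toFinset_card']
    refine prod_le_card_of_forall_line _ _ ⟨p₀, by simpa using hp₀⟩ fun i p hp => ?_
    obtain ⟨P, hdeg, hP⟩ := exists_polynomial_eval_update k c i p
    have hP0 : P ≠ 0 := by
      rintro rfl
      have := hP (p i)
      rw [Function.update_eq_self, Polynomial.eval_zero] at this
      simp [← this] at hp
    simpa [hcard, hP] using card_units_sub_le_card_eval_ne_zero hP0 hdeg
  · have hA (i : Fin m) : ∃ A : Finset Fˣ, A.card = k i := by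
      obtain ⟨A, -, hA⟩ := Finset.exists_subset_card_eq (s := (Finset.univ : Finset Fˣ))
        (n := k i) (by rw [Finset.card_univ, hcard]; exact (hk i).le)
      exact ⟨A, hA⟩
    choose A hA using hA
    let P (i : Fin m) : Polynomial F := ∏ a ∈ A i, (Polynomial.X - Polynomial.C (a : F))
    have hP (i : Fin m) : (P i).natDegree ≤ k i := by
      simp [P, Polynomial.natDegree_prod_of_monic, Polynomial.monic_X_sub_C, hA]
    have hsupp : {p : Fin m → Fˣ | ∏ i, (P i).eval (p i : F) ≠ 0} =
        (Fintype.piFinset fun i => (A i)ᶜ : Finset (Fin m → Fˣ)) := by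
      ext p
      simp only [P, Polynomial.eval_prod, Polynomial.eval_sub, Polynomial.eval_X,
        Polynomial.eval_C, Finset.prod_ne_zero_iff, sub_ne_zero, ne_eq, Units.val_inj,
        Set.mem_ofPred_eq, Finset.mem_univ, true_imp_iff, Finset.mem_coe, Fintype.mem_piFinset,
        Finset.mem_compl]
      exact forall_congr' fun i => ⟨fun h hi => h _ hi rfl, fun h a ha hpa => h (hpa ▸ ha)⟩
    have hncard : {p : Fin m → Fˣ | ∏ i, (P i).eval (p i : F) ≠ 0}.ncard =
        ∏ i, (q - 1 - k i) := by
      rw [hsupp, Set.ncard_coe_finset, Fintype.card_piFinset]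
      simp [Finset.card_compl, hcard, hA]
    refine ⟨fun p => ∏ i, (P i).eval (p i : F), ⟨fun e => ∏ i, (P i).coeff (e i),
      funext fun p => prod_eval_eq_sum_box k P hP _⟩, fun h0 => ?_, hncard⟩
    have hpos : 0 < ∏ i, (q - 1 - k i) := Finset.prod_pos fun i _ => Nat.sub_pos_of_lt (hk i)
    rw [← hncard] at hpos
    obtain ⟨p, hp⟩ := Set.nonempty_of_ncard_ne_zero hpos.ne'
    exact hp (congrFun h0 p)
end

section
/- Let F be a field, m ≥ 2, ℓ ≥ 1. Let S = S' ∪ S'' be an m-dimensional ℓ-th order simplicial configuration with all points of S'' lying on the hyperplane x_m = c and S' the points on the other ℓ hyperplanes. Let π: F^m → F^{m−1} be projection onto the first m−1 coordinates. Then det V(P_ℓ(m); S) = ± ∏_{p ∈ S'} (p_m − c) · det V(P_{ℓ−1}(m); S') · det V(P_ℓ(m−1); π(S'')). -/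
/-- Simplicial configuration, as in the paper (dimension is `m + 1`). -/
def IsSimplicialConfig (F : Type*) [DecidableEq F] :
    (m : ℕ) → (l : ℕ) → Finset (Fin (m + 1) → F) → Prop
  | 0, l, S => S.card = l + 1
  | m + 1, l, S =>
      S.card = Nat.choose (m + 2 + l) l ∧
      ∃ a : Fin (l + 1) → F, Function.Injective a ∧
        (∀ p ∈ S, ∃ j, p (Fin.last (m + 1)) = a j) ∧
        ∀ j : Fin (l + 1),
          (S.filter fun p => p (Fin.last (m + 1)) = a j).card
            = Nat.choose (m + 1 + (j : ℕ)) (j : ℕ) ∧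
          IsSimplicialConfig F m (j : ℕ)
            ((S.filter fun p => p (Fin.last (m + 1)) = a j).image fun p => p ∘ Fin.castSucc)

/-- A matrix that differs from the identity by a strictly lower triangular matrix, with respect to
some grading of the index type, has determinant one. -/
theorem Matrix.det_one_add_of_strictly_lower {n R : Type*} [Fintype n] [DecidableEq n]
    [CommRing R] (d : n → ℕ) (N : Matrix n n R) (hN : ∀ i j, d i ≤ d j → N i j = 0) :
    (1 + N).det = 1 := by
  have ht : (1 + N).BlockTriangular (OrderDual.toDual ∘ d) := by
    intro i j hij
    have hlt : d i < d j := hij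
    have hne : i ≠ j := by
      rintro rfl
      exact lt_irrefl _ hlt
    simp [Matrix.one_apply_ne hne, hN i j hlt.le]
  rw [ht.det]
  refine Finset.prod_eq_one fun a _ => ?_
  have hblock : (1 + N).toSquareBlock (OrderDual.toDual ∘ d) a = 1 := by
    ext ⟨i, hi⟩ ⟨j, hj⟩
    have hd : d i = d j := hi.trans hj.symm
    simp [Matrix.toSquareBlock_def, Matrix.one_apply, hN i j hd.le]
  rw [hblock, Matrix.det_one]

/-- Reindexing rows and columns by two equivalences changes the determinant at most by a sign. -/
theorem Matrix.det_eq_or_eq_neg_det_submatrix {n k R : Type*} [Fintype n] [DecidableEq n]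
    [Fintype k] [DecidableEq k] [CommRing R] (r s : k ≃ n) (M : Matrix n n R) :
    M.det = (M.submatrix r s).det ∨ M.det = -(M.submatrix r s).det := by
  have h : (M.submatrix r s).det = Equiv.Perm.sign (r.symm.trans s) * M.det := by
    rw [← Matrix.det_permute', ← Matrix.det_submatrix_equiv_self r]
    congr 1
    ext i j
    simp
  rcases Int.units_eq_one_or (Equiv.Perm.sign (r.symm.trans s)) with hs | hs <;>
    simp [h, hs]

/-- Exponent vectors of degree at most `l`. -/
abbrev BoundedExponent (k l : ℕ) : Type :=
  {e : Fin k → Fin (l + 1) // ∑ i, ((e i : ℕ)) ≤ l}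

namespace BoundedExponent

/-- Regard an exponent vector of degree at most `l` as one of degree at most `l + 1`. -/
def weaken {k l : ℕ} (e : BoundedExponent k l) : BoundedExponent k (l + 1) :=
  ⟨fun i => (e.1 i).castSucc, by simpa using e.2.trans l.le_succ⟩

/-- Raise the last exponent by one. -/
def raiseLast {k l : ℕ} (e : BoundedExponent (k + 1) l) : BoundedExponent (k + 1) (l + 1) :=
  ⟨Fin.snoc (α := fun _ => Fin (l + 2)) (fun i => (e.1 i.castSucc).castSucc)
      (e.1 (Fin.last k)).succ, by
    have h := e.2
    rw [Fin.sum_univ_castSucc] at h ⊢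
    simp only [Fin.snoc_castSucc, Fin.snoc_last, Fin.val_castSucc, Fin.val_succ]
    omega⟩

/-- Append a zero exponent. -/
def snocZero {k l : ℕ} (e : BoundedExponent k l) : BoundedExponent (k + 1) l :=
  ⟨Fin.snoc (α := fun _ => Fin (l + 1)) e.1 0, by
    rw [Fin.sum_univ_castSucc]
    simpa using e.2⟩

/-- Exponent vectors split according to whether the last exponent is positive or zero. -/
theorem bijective_elim_raiseLast_snocZero (k l : ℕ) :
    Function.Bijective (Sum.elim raiseLast snocZero :
      BoundedExponent (k + 1) l ⊕ BoundedExponent k (l + 1) → BoundedExponent (k + 1) (l + 1)) := by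
  constructor
  · rintro (a | a) (b | b) h <;>
      simp only [Sum.elim_inl, Sum.elim_inr, raiseLast, snocZero, Subtype.mk.injEq,
        Fin.snoc_inj] at h
    · congr 1
      apply Subtype.ext
      funext i
      refine Fin.lastCases (Fin.succ_injective _ h.2) (fun j => ?_) i
      exact Fin.castSucc_injective _ (congrFun h.1 j)
    · exact absurd h.2 (Fin.succ_ne_zero _)
    · exact absurd h.2.symm (Fin.succ_ne_zero _)
    · exact congrArg Sum.inr (Subtype.ext h.1)
  · intro e
    have he := e.2
    rw [Fin.sum_univ_castSucc] at he
    by_cases h0 : e.1 (Fin.last k) = 0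
    · refine ⟨Sum.inr ⟨fun i => e.1 i.castSucc, (Nat.le_add_right _ _).trans he⟩, Subtype.ext ?_⟩
      funext i
      refine Fin.lastCases ?_ (fun j => ?_) i <;> simp [snocZero, h0]
    · have hpos : 0 < (e.1 (Fin.last k) : ℕ) := Nat.pos_of_ne_zero fun h => h0 (Fin.ext h)
      have hj (j : Fin k) : (e.1 j.castSucc : ℕ) < l + 1 := by
        have := Finset.single_le_sum (f := fun i : Fin k => (e.1 i.castSucc : ℕ))
          (fun _ _ => Nat.zero_le _) (Finset.mem_univ j)
        omega
      have hl : (e.1 (Fin.last k) : ℕ) - 1 < l + 1 := by omega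
      refine ⟨Sum.inl ⟨Fin.snoc (α := fun _ => Fin (l + 1)) (fun j => ⟨e.1 j.castSucc, hj j⟩)
        ⟨(e.1 (Fin.last k) : ℕ) - 1, hl⟩, ?_⟩, Subtype.ext ?_⟩
      · rw [Fin.sum_univ_castSucc]
        simp only [Fin.snoc_castSucc, Fin.snoc_last]
        omega
      · funext i
        refine Fin.lastCases ?_ (fun j => ?_) i
        · apply Fin.ext
          simp only [Sum.elim_inl, raiseLast, Fin.snoc_last, Fin.val_succ]
          omega
        · apply Fin.ext
          simp [raiseLast]

/-- The splitting of exponent vectors by positivity of the last exponent. -/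
noncomputable def sumEquiv (k l : ℕ) :
    BoundedExponent (k + 1) l ⊕ BoundedExponent k (l + 1) ≃ BoundedExponent (k + 1) (l + 1) :=
  Equiv.ofBijective _ (bijective_elim_raiseLast_snocZero k l)

/-- The value at a point of the monomial with a given exponent vector. -/
def monomialEval {F : Type*} [Field F] {k l : ℕ} (e : BoundedExponent k l) (p : Fin k → F) : F :=
  ∏ i, p i ^ (e.1 i : ℕ)

theorem monomialEval_raiseLast {F : Type*} [Field F] {k l : ℕ} (e : BoundedExponent (k + 1) l)
    (p : Fin (k + 1) → F) :
    e.raiseLast.monomialEval p = p (Fin.last k) * e.monomialEval p := by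
  simp only [monomialEval, raiseLast, Fin.prod_univ_castSucc, Fin.snoc_castSucc, Fin.snoc_last,
    Fin.val_castSucc, Fin.val_succ, pow_succ]
  ring

theorem monomialEval_weaken {F : Type*} [Field F] {k l : ℕ} (e : BoundedExponent k l)
    (p : Fin k → F) : e.weaken.monomialEval p = e.monomialEval p := rfl

theorem monomialEval_snocZero {F : Type*} [Field F] {k l : ℕ} (e : BoundedExponent k l)
    (p : Fin (k + 1) → F) :
    e.snocZero.monomialEval p = e.monomialEval (p ∘ Fin.castSucc) := by
  simp [monomialEval, snocZero, Fin.prod_univ_castSucc]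

/-- Subtracting `c` times the row of `e.weaken` from the row of `e.raiseLast`, for all `e`, does not
change the determinant. -/
theorem det_eq_det_of_row_sub {R : Type*} [CommRing R] {k l : ℕ} (c : R)
    (M N : Matrix (BoundedExponent (k + 1) (l + 1)) (BoundedExponent (k + 1) (l + 1)) R)
    (hraise : ∀ e j, N (raiseLast e) j = M (raiseLast e) j - c * M (weaken e) j)
    (hzero : ∀ e j, N (snocZero e) j = M (snocZero e) j) :
    M.det = N.det := by
  let T : Matrix (BoundedExponent (k + 1) (l + 1)) (BoundedExponent (k + 1) (l + 1)) R :=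
    Matrix.of fun i j => Sum.elim (fun e => if j = weaken e then -c else 0) (fun _ => 0)
      ((sumEquiv k l).symm i)
  have hT : (1 + T).det = 1 := by
    refine Matrix.det_one_add_of_strictly_lower (fun e => (e.1 (Fin.last k) : ℕ)) T ?_
    intro i j hij
    obtain ⟨e | e, rfl⟩ := (sumEquiv k l).surjective i
    · have hne : j ≠ weaken e := by
        rintro rfl
        simp [sumEquiv, raiseLast, weaken] at hij
      simp [T, hne]
    · simp [T]
  have hmul : (1 + T) * M = N := by
    ext i j
    rw [add_mul, one_mul, Matrix.add_apply, Matrix.mul_apply]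
    obtain ⟨e | e, rfl⟩ := (sumEquiv k l).surjective i
    · simp only [T, Matrix.of_apply, Equiv.symm_apply_apply, Sum.elim_inl, ite_mul, zero_mul,
        Finset.sum_ite_eq', Finset.mem_univ, if_true]
      rw [neg_mul, ← sub_eq_add_neg]
      exact (hraise e j).symm
    · simp only [T, Matrix.of_apply, Equiv.symm_apply_apply, Sum.elim_inr, zero_mul,
        Finset.sum_const_zero, add_zero]
      exact (hzero e j).symm
  rw [← hmul, Matrix.det_mul, hT, one_mul]

end BoundedExponent

/-- Points on a hyperplane `x_m = c` are determined by their projection. -/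
theorem bijective_image_comp_castSucc {F : Type*} [DecidableEq F] {k : ℕ} {c : F}
    {s : Finset (Fin (k + 1) → F)} (hs : ∀ p ∈ s, p (Fin.last k) = c) :
    Function.Bijective (fun p : s =>
      (⟨p.1 ∘ Fin.castSucc, Finset.mem_image_of_mem _ p.2⟩ :
        (s.image fun p => p ∘ Fin.castSucc : Finset (Fin k → F)))) := by
  constructor
  · intro p q h
    apply Subtype.ext
    funext i
    refine Fin.lastCases ((hs _ p.2).trans (hs _ q.2).symm) (fun j => ?_) i
    exact congrFun (congrArg Subtype.val h) j
  · rintro ⟨q, hq⟩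
    obtain ⟨p, hp, rfl⟩ := Finset.mem_image.1 hq
    exact ⟨⟨p, hp⟩, rfl⟩

/-- Recurrence for simplex Vandermonde determinants.  Here the ambient dimension is
`m + 2 ≥ 2` and the order is `l + 1 ≥ 1`.  `S = S' ∪ S''` is a simplicial configuration of
order `l + 1`, where `S''` is the set of points on the hyperplane `x_m = c` and `S'` (a
simplicial configuration of order `l`) the points on the other `l + 1` hyperplanes; the
projection `π(S'')` is an `(m+1)`-dimensional configuration of order `l + 1`.  Then
`det V(P_{l+1}(m+2); S) = ± ∏_{p ∈ S'} (p_m - c) · det V(P_l(m+2); S') · det V(P_{l+1}(m+1); π(S''))`. -/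
theorem simplex_vandermonde_recurrence {F : Type*} [Field F] [DecidableEq F] (m l : ℕ) (c : F)
    (S S' S'' : Finset (Fin (m + 2) → F))
    (hS : S = S' ∪ S'') (hdisj : Disjoint S' S'')
    (hconf : IsSimplicialConfig F (m + 1) (l + 1) S)
    (hS'' : ∀ p ∈ S'', p (Fin.last (m + 1)) = c)
    (hS' : ∀ p ∈ S', p (Fin.last (m + 1)) ≠ c)
    (hconf' : IsSimplicialConfig F (m + 1) l S')
    (hconf'' : IsSimplicialConfig F m (l + 1) (S''.image fun p => p ∘ Fin.castSucc))
    (e1 : {e : Fin (m + 2) → Fin (l + 2) // ∑ i, ((e i : ℕ)) ≤ l + 1} ≃ S)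
    (e2 : {e : Fin (m + 2) → Fin (l + 1) // ∑ i, ((e i : ℕ)) ≤ l} ≃ S')
    (e3 : {e : Fin (m + 1) → Fin (l + 2) // ∑ i, ((e i : ℕ)) ≤ l + 1}
            ≃ (S''.image fun p => p ∘ Fin.castSucc)) :
    (Matrix.of fun e e' : {e : Fin (m + 2) → Fin (l + 2) // ∑ i, ((e i : ℕ)) ≤ l + 1} =>
        ∏ i, ((e1 e' : Fin (m + 2) → F) i) ^ ((e : Fin (m + 2) → Fin (l + 2)) i : ℕ)).det
      = (∏ p ∈ S', (p (Fin.last (m + 1)) - c)) *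
        (Matrix.of fun e e' : {e : Fin (m + 2) → Fin (l + 1) // ∑ i, ((e i : ℕ)) ≤ l} =>
          ∏ i, ((e2 e' : Fin (m + 2) → F) i) ^ ((e : Fin (m + 2) → Fin (l + 1)) i : ℕ)).det *
        (Matrix.of fun e e' : {e : Fin (m + 1) → Fin (l + 2) // ∑ i, ((e i : ℕ)) ≤ l + 1} =>
          ∏ i, ((e3 e' : Fin (m + 1) → F) i) ^ ((e : Fin (m + 1) → Fin (l + 2)) i : ℕ)).det
    ∨
    (Matrix.of fun e e' : {e : Fin (m + 2) → Fin (l + 2) // ∑ i, ((e i : ℕ)) ≤ l + 1} =>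
        ∏ i, ((e1 e' : Fin (m + 2) → F) i) ^ ((e : Fin (m + 2) → Fin (l + 2)) i : ℕ)).det
      = -((∏ p ∈ S', (p (Fin.last (m + 1)) - c)) *
        (Matrix.of fun e e' : {e : Fin (m + 2) → Fin (l + 1) // ∑ i, ((e i : ℕ)) ≤ l} =>
          ∏ i, ((e2 e' : Fin (m + 2) → F) i) ^ ((e : Fin (m + 2) → Fin (l + 1)) i : ℕ)).det *
        (Matrix.of fun e e' : {e : Fin (m + 1) → Fin (l + 2) // ∑ i, ((e i : ℕ)) ≤ l + 1} =>
          ∏ i, ((e3 e' : Fin (m + 1) → F) i) ^ ((e : Fin (m + 1) → Fin (l + 2)) i : ℕ)).det) := by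
  subst hS
  let col : BoundedExponent (m + 2) l ⊕ BoundedExponent (m + 1) (l + 1) ≃
      BoundedExponent (m + 2) (l + 1) :=
    ((e2.sumCongr (e3.trans (Equiv.ofBijective _ (bijective_image_comp_castSucc hS'')).symm)).trans
      (Equiv.Finset.union S' S'' hdisj)).trans e1.symm
  have hcol_inl (b : BoundedExponent (m + 2) l) :
      (e1 (col (Sum.inl b)) : Fin (m + 2) → F) = e2 b := by
    simp [col]
  have hcol_last (d : BoundedExponent (m + 1) (l + 1)) :
      (e1 (col (Sum.inr d)) : Fin (m + 2) → F) (Fin.last (m + 1)) = c := by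
    simp only [col, Equiv.trans_apply, Equiv.apply_symm_apply, Equiv.sumCongr_apply, Sum.map_inr,
      Equiv.Finset.union_inr]
    exact hS'' _ (Subtype.prop _)
  have hcol_proj (d : BoundedExponent (m + 1) (l + 1)) :
      (e1 (col (Sum.inr d)) : Fin (m + 2) → F) ∘ Fin.castSucc = e3 d := by
    simp only [col, Equiv.trans_apply, Equiv.apply_symm_apply, Equiv.sumCongr_apply, Sum.map_inr,
      Equiv.Finset.union_inr]
    exact congrArg Subtype.val
      ((Equiv.ofBijective _ (bijective_image_comp_castSucc hS'')).apply_symm_apply (e3 d))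
  let N : Matrix (BoundedExponent (m + 2) (l + 1)) (BoundedExponent (m + 2) (l + 1)) F :=
    Matrix.of fun e e' => Sum.elim
      (fun b => ((e1 e' : Fin (m + 2) → F) (Fin.last (m + 1)) - c) * b.monomialEval (e1 e').1)
      (fun d => d.monomialEval ((e1 e').1 ∘ Fin.castSucc))
      ((BoundedExponent.sumEquiv (m + 1) l).symm e)
  have hN_inl (b : BoundedExponent (m + 2) l) (e') : N b.raiseLast e' =
      ((e1 e' : Fin (m + 2) → F) (Fin.last (m + 1)) - c) * b.monomialEval (e1 e').1 := by
    have h : (BoundedExponent.sumEquiv (m + 1) l).symm b.raiseLast = Sum.inl b :=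
      (Equiv.symm_apply_eq _).2 rfl
    simp [N, h]
  have hN_inr (d : BoundedExponent (m + 1) (l + 1)) (e') : N d.snocZero e' =
      d.monomialEval ((e1 e').1 ∘ Fin.castSucc) := by
    have h : (BoundedExponent.sumEquiv (m + 1) l).symm d.snocZero = Sum.inr d :=
      (Equiv.symm_apply_eq _).2 rfl
    simp [N, h]
  have hMN : (Matrix.of fun e e' : BoundedExponent (m + 2) (l + 1) =>
      e.monomialEval (e1 e').1).det = N.det := by
    refine BoundedExponent.det_eq_det_of_row_sub c _ _ (fun e j => ?_) (fun e j => ?_)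
    · simp only [hN_inl, Matrix.of_apply, BoundedExponent.monomialEval_raiseLast,
        BoundedExponent.monomialEval_weaken]
      ring
    · simp only [hN_inr, Matrix.of_apply, BoundedExponent.monomialEval_snocZero]
  have hblocks : N.submatrix (BoundedExponent.sumEquiv (m + 1) l) col =
      Matrix.fromBlocks
        (Matrix.of fun b b' : BoundedExponent (m + 2) l =>
          ((e2 b' : Fin (m + 2) → F) (Fin.last (m + 1)) - c) *
            (Matrix.of fun e e' => e.monomialEval (e2 e').1) b b')
        0
        (Matrix.of fun (d : BoundedExponent (m + 1) (l + 1)) (b : BoundedExponent (m + 2) l) =>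
          d.monomialEval ((e2 b : Fin (m + 2) → F) ∘ Fin.castSucc))
        (Matrix.of fun d d' : BoundedExponent (m + 1) (l + 1) => d.monomialEval (e3 d').1) := by
    ext (b | d) (b' | d')
    · exact (hN_inl b _).trans (by simp [hcol_inl])
    · exact (hN_inl b _).trans (by simp [hcol_last])
    · exact (hN_inr d _).trans (by simp [hcol_inl])
    · exact (hN_inr d _).trans (by simp [hcol_proj])
  have hprod : ∏ b, ((e2 b : Fin (m + 2) → F) (Fin.last (m + 1)) - c) =
      ∏ p ∈ S', (p (Fin.last (m + 1)) - c) := by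
    rw [e2.prod_comp fun p : S' => p.1 (Fin.last (m + 1)) - c]
    exact Finset.prod_coe_sort S' fun p => p (Fin.last (m + 1)) - c
  have hdet : (N.submatrix (BoundedExponent.sumEquiv (m + 1) l) col).det =
      (∏ p ∈ S', (p (Fin.last (m + 1)) - c)) *
        (Matrix.of fun e e' : BoundedExponent (m + 2) l => e.monomialEval (e2 e').1).det *
        (Matrix.of fun e e' : BoundedExponent (m + 1) (l + 1) =>
          e.monomialEval (e3 e').1).det := by
    rw [hblocks, Matrix.det_fromBlocks_zero₁₂, Matrix.det_mul_row, hprod]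
  have key := Matrix.det_eq_or_eq_neg_det_submatrix (BoundedExponent.sumEquiv (m + 1) l) col N
  rw [hdet, ← hMN] at key
  exact key
end
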